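/- arXiv:2307.07625 — 3 statements merged into one kernel-verified Lean document; each statement's English description precedes it below -/
import Mathlib

section
/- For all b ≥ 1, ρ ∈ (0,1], Δ ≥ 1 and q ≥ 2 there exists a constant α = α(b,ρ,Δ,q) > 0 such that for every n ≥ 1, every probability measure ν on Σ^n (|Σ| = q) satisfying Assumption A, and every f : Σ^n → {0,1}, there exists a coordinate k ∈ [n] with I_k(f) ≥ α · Var_ν(f) · log(n)/n. (Generalized KKL theorem.) -/
open scoped Classical BigOperators

noncomputable section

abbrev Cfg (σ : Type) (n : ℕ) : Type := Fin n → σ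

variable {σ : Type} [Fintype σ] [DecidableEq σ] {n : ℕ}

/-- Expectation of `f` under the discrete measure `ν`. -/
def expct (ν f : Cfg σ n → ℝ) : ℝ := ∑ x, ν x * f x

/-- Variance of `f` under `ν`. -/
def varnc (ν f : Cfg σ n → ℝ) : ℝ := expct ν (fun x => (f x - expct ν f) ^ 2)

/-- ν is a fully supported probability measure. -/
def IsProb (ν : Cfg σ n → ℝ) : Prop := (∀ x, 0 < ν x) ∧ ∑ x, ν x = 1

/-- `(P_i f)(x) = E[f(X) | X_j = x_j ∀ j ≠ i]`. -/
def Pop (ν : Cfg σ n → ℝ) (i : Fin n) (f : Cfg σ n → ℝ) (x : Cfg σ n) : ℝ :=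
  (∑ y ∈ Finset.univ.filter (fun y : Cfg σ n => ∀ j, j ≠ i → y j = x j), ν y * f y) /
    (∑ y ∈ Finset.univ.filter (fun y : Cfg σ n => ∀ j, j ≠ i → y j = x j), ν y)

/-- `L_i f = P_i f - f`. -/
def Lop (ν : Cfg σ n → ℝ) (i : Fin n) (f : Cfg σ n → ℝ) (x : Cfg σ n) : ℝ :=
  Pop ν i f x - f x

/-- `‖f‖_p = (E_ν |f|^p)^{1/p}`. -/
def pnorm (ν : Cfg σ n → ℝ) (p : ℝ) (f : Cfg σ n → ℝ) : ℝ :=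
  (∑ x, ν x * |f x| ^ p) ^ (1 / p)

/-- Relative-entropy functional `Ent_ν[g]`. -/
def entFun (ν g : Cfg σ n → ℝ) : ℝ :=
  expct ν (fun x => g x * Real.log (g x)) - expct ν g * Real.log (expct ν g)

/-- The log-Sobolev inequality with constant `ρ` for the Glauber dynamics of `ν`. -/
def LogSobolev (ν : Cfg σ n → ℝ) (ρ : ℝ) : Prop :=
  ∀ g : Cfg σ n → ℝ, (∀ x, 0 ≤ g x) →
    ρ * entFun ν g ≤ 2 * ∑ i : Fin n, expct ν (fun x => (Lop ν i (fun y => Real.sqrt (g y)) x) ^ 2)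

/-- `ν` is `b`-marginally bounded. -/
def MargBounded (ν : Cfg σ n → ℝ) (b : ℝ) : Prop :=
  ∀ x y : Cfg σ n, hammingDist x y = 1 → 1 / b ≤ ν x / ν y ∧ ν x / ν y ≤ b

/-- Conditional probability `Pr[X_i = a | X_j = x_j ∀ j ≠ i]`. -/
def condProb (ν : Cfg σ n → ℝ) (i : Fin n) (x : Cfg σ n) (a : σ) : ℝ :=
  ν (Function.update x i a) / ∑ a' : σ, ν (Function.update x i a')

/-- `ν` is a Markov random field w.r.t. `G`: the conditional law of `X_i` given all other
coordinates depends only on the neighbors of `i` in `G`. -/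
def IsMRF (ν : Cfg σ n → ℝ) (G : SimpleGraph (Fin n)) : Prop :=
  ∀ (i : Fin n) (x y : Cfg σ n), (∀ j, G.Adj i j → x j = y j) →
    ∀ a : σ, condProb ν i x a = condProb ν i y a

/-- The graph `G` has maximum degree at most `Δ`. -/
def MaxDegLE {m : ℕ} (G : SimpleGraph (Fin m)) (Δ : ℕ) : Prop :=
  ∀ i, (Finset.univ.filter fun j => G.Adj i j).card ≤ Δ

/-- Assumption A: fully supported probability measure, `b`-marginally bounded,
log-Sobolev with constant `ρ ∈ (0,1]`, and an MRF w.r.t. a graph of max degree `Δ`. -/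
def AssumptionA (ν : Cfg σ n → ℝ) (b ρ : ℝ) (Δ : ℕ) : Prop :=
  IsProb ν ∧ 1 ≤ b ∧ MargBounded ν b ∧ 0 < ρ ∧ ρ ≤ 1 ∧ LogSobolev ν ρ ∧
    ∃ G : SimpleGraph (Fin n), IsMRF ν G ∧ MaxDegLE G Δ

/-- Influence of coordinate `i` on `f`. -/
def influence (ν : Cfg σ n → ℝ) (f : Cfg σ n → ℝ) (i : Fin n) : ℝ :=
  ∑ x ∈ Finset.univ.filter (fun x : Cfg σ n => ∃ a : σ, f (Function.update x i a) ≠ f x), ν x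

set_option linter.unusedSectionVars false

/-- The `i`-fibre of configurations agreeing with `x` off coordinate `i`. -/
def fibre (i : Fin n) (x : Cfg σ n) : Finset (Cfg σ n) :=
  Finset.univ.filter (fun y : Cfg σ n => ∀ j, j ≠ i → y j = x j)

lemma mem_fibre {i : Fin n} {x y : Cfg σ n} : y ∈ fibre i x ↔ ∀ j, j ≠ i → y j = x j := by
  simp [fibre]

lemma mem_fibre_comm {i : Fin n} {x y : Cfg σ n} : y ∈ fibre i x ↔ x ∈ fibre i y := by
  simp only [mem_fibre]
  exact ⟨fun h j hj => (h j hj).symm, fun h j hj => (h j hj).symm⟩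

lemma self_mem_fibre (i : Fin n) (x : Cfg σ n) : x ∈ fibre i x := by
  simp [mem_fibre]

lemma fibre_eq {i : Fin n} {x y : Cfg σ n} (h : y ∈ fibre i x) : fibre i y = fibre i x := by
  ext z
  simp only [mem_fibre] at h ⊢
  exact ⟨fun hz j hj => (hz j hj).trans (h j hj), fun hz j hj => (hz j hj).trans (h j hj).symm⟩

lemma sum_fibre (i : Fin n) (x : Cfg σ n) (g : Cfg σ n → ℝ) :
    ∑ y ∈ fibre i x, g y = ∑ a, g (Function.update x i a) := by
  symm
  refine Finset.sum_bij (fun a _ => Function.update x i a) ?_ ?_ ?_ ?_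
  · intro a _
    rw [mem_fibre]
    intro j hj
    simp [hj]
  · intro a _ a' _ h
    simpa using congrFun h i
  · intro y hy
    refine ⟨y i, Finset.mem_univ _, ?_⟩
    ext j
    by_cases hj : j = i
    · subst hj; simp
    · simp [hj, mem_fibre.1 hy j hj]
  · intros; rfl

lemma Pop_eq_fibre (ν : Cfg σ n → ℝ) (i : Fin n) (f : Cfg σ n → ℝ) (x : Cfg σ n) :
    Pop ν i f x = (∑ y ∈ fibre i x, ν y * f y) / ∑ y ∈ fibre i x, ν y := rfl

lemma Pop_eq_sum_condProb (ν : Cfg σ n → ℝ) (i : Fin n) (f : Cfg σ n → ℝ) (x : Cfg σ n) :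
    Pop ν i f x = ∑ a, condProb ν i x a * f (Function.update x i a) := by
  rw [Pop_eq_fibre, sum_fibre, sum_fibre, Finset.sum_div]
  refine Finset.sum_congr rfl fun a _ => ?_
  rw [condProb]; ring

/-- `Pop` as a linear map. -/
def popLin (ν : Cfg σ n → ℝ) (i : Fin n) : (Cfg σ n → ℝ) →ₗ[ℝ] (Cfg σ n → ℝ) where
  toFun := Pop ν i
  map_add' f g := by
    ext x
    simp only [Pop_eq_sum_condProb, Pi.add_apply, mul_add, Finset.sum_add_distrib]
  map_smul' c f := by
    ext x
    simp only [Pop_eq_sum_condProb, Pi.smul_apply, smul_eq_mul, Finset.mul_sum, RingHom.id_apply]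
    exact Finset.sum_congr rfl fun a _ => by ring

/-- `Lop` as a linear map. -/
def lopLin (ν : Cfg σ n → ℝ) (i : Fin n) : (Cfg σ n → ℝ) →ₗ[ℝ] (Cfg σ n → ℝ) :=
  popLin ν i - LinearMap.id

lemma popLin_apply (ν : Cfg σ n → ℝ) (i : Fin n) (f : Cfg σ n → ℝ) :
    popLin ν i f = Pop ν i f := rfl

lemma lopLin_apply (ν : Cfg σ n → ℝ) (i : Fin n) (f : Cfg σ n → ℝ) :
    lopLin ν i f = popLin ν i f - f := rfl

/-- The inner product of `L²(ν)`. -/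
def ip (ν : Cfg σ n → ℝ) : (Cfg σ n → ℝ) →ₗ[ℝ] (Cfg σ n → ℝ) →ₗ[ℝ] ℝ :=
  LinearMap.mk₂ ℝ (fun f g => ∑ x, ν x * (f x * g x))
    (fun f f' g => by simp only [Pi.add_apply, add_mul, mul_add, Finset.sum_add_distrib])
    (fun c f g => by
      simp only [Pi.smul_apply, smul_eq_mul, Finset.mul_sum]
      exact Finset.sum_congr rfl fun a _ => by ring)
    (fun f g g' => by simp only [Pi.add_apply, mul_add, Finset.sum_add_distrib])
    (fun c f g => by
      simp only [Pi.smul_apply, smul_eq_mul, Finset.mul_sum]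
      exact Finset.sum_congr rfl fun a _ => by ring)

lemma ip_apply (ν f g : Cfg σ n → ℝ) : ip ν f g = ∑ x, ν x * (f x * g x) := rfl

lemma ip_comm (ν f g : Cfg σ n → ℝ) : ip ν f g = ip ν g f := by
  simp only [ip_apply, mul_comm]

lemma expct_sq (ν f : Cfg σ n → ℝ) : expct ν (fun x => f x ^ 2) = ip ν f f := by
  simp only [expct, ip_apply, sq]

/-- The norm of `L¹(ν)`. -/
def normOne (ν f : Cfg σ n → ℝ) : ℝ := expct ν (fun x => |f x|)

lemma ip_popLin_comm (ν : Cfg σ n → ℝ) (i : Fin n) (f g : Cfg σ n → ℝ) :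
    ip ν (popLin ν i f) g = ip ν f (popLin ν i g) := by
  have key : ∀ u v : Cfg σ n → ℝ, ip ν u (popLin ν i v) =
      ∑ x, ∑ y, if y ∈ fibre i x then ν x * ν y * u x * v y / ∑ z ∈ fibre i x, ν z else 0 := by
    intro u v
    rw [ip_apply]
    refine Finset.sum_congr rfl fun x _ => ?_
    rw [Finset.sum_ite_mem, Finset.univ_inter, popLin_apply, Pop_eq_fibre, ← Finset.sum_div,
      mul_div_assoc', mul_div_assoc', Finset.mul_sum, Finset.mul_sum]
    congr 1
    exact Finset.sum_congr rfl fun y _ => by ring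
  rw [ip_comm, key, key, Finset.sum_comm]
  refine Finset.sum_congr rfl fun x _ => Finset.sum_congr rfl fun y _ => ?_
  by_cases h : y ∈ fibre i x
  · rw [if_pos h, if_pos (mem_fibre_comm.1 h), fibre_eq h]; ring
  · rw [if_neg h, if_neg (fun h' => h (mem_fibre_comm.1 h'))]

lemma ip_lopLin_comm (ν : Cfg σ n → ℝ) (i : Fin n) (f g : Cfg σ n → ℝ) :
    ip ν (lopLin ν i f) g = ip ν f (lopLin ν i g) := by
  simp only [lopLin_apply, map_sub, LinearMap.sub_apply, ip_popLin_comm]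

lemma normOne_eq_ip (ν f : Cfg σ n → ℝ) : normOne ν f = ip ν 1 |f| := by
  simp [normOne, expct, ip_apply]

lemma normOne_smul (c : ℝ) (ν f : Cfg σ n → ℝ) :
    normOne ν (c • f) = |c| * normOne ν f := by
  simp only [normOne, expct, Pi.smul_apply, smul_eq_mul, abs_mul, Finset.mul_sum]
  exact Finset.sum_congr rfl fun x _ => by ring

section

variable {ν : Cfg σ n → ℝ} (hν : IsProb ν)

include hν

lemma fibre_weight_pos (i : Fin n) (x : Cfg σ n) : 0 < ∑ y ∈ fibre i x, ν y :=
  Finset.sum_pos (fun y _ => hν.1 y) ⟨x, self_mem_fibre i x⟩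

lemma popLin_of_const_on_fibre (i : Fin n) (f : Cfg σ n → ℝ) (x : Cfg σ n)
    (h : ∀ y ∈ fibre i x, f y = f x) : popLin ν i f x = f x := by
  rw [popLin_apply, Pop_eq_fibre, div_eq_iff (fibre_weight_pos hν i x).ne', Finset.mul_sum]
  exact Finset.sum_congr rfl fun y hy => by rw [h y hy, mul_comm]

lemma popLin_popLin (i : Fin n) (f : Cfg σ n → ℝ) : popLin ν i (popLin ν i f) = popLin ν i f := by
  ext x
  refine popLin_of_const_on_fibre hν i _ x fun y hy => ?_
  simp only [popLin_apply, Pop_eq_fibre, fibre_eq hy]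

lemma popLin_one (i : Fin n) : popLin ν i 1 = 1 := by
  ext x
  exact popLin_of_const_on_fibre hν i _ x fun y _ => rfl

lemma popLin_mono (i : Fin n) {f g : Cfg σ n → ℝ} (h : ∀ x, f x ≤ g x) (x : Cfg σ n) :
    popLin ν i f x ≤ popLin ν i g x := by
  simp only [popLin_apply, Pop_eq_fibre]
  refine div_le_div_of_nonneg_right ?_ (fibre_weight_pos hν i x).le
  exact Finset.sum_le_sum fun y _ => mul_le_mul_of_nonneg_left (h y) (hν.1 y).le

lemma abs_popLin_le (i : Fin n) (f : Cfg σ n → ℝ) (x : Cfg σ n) :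
    |popLin ν i f x| ≤ popLin ν i |f| x := by
  refine abs_le.2 ⟨?_, popLin_mono hν i (fun y => le_abs_self (f y)) x⟩
  have := popLin_mono hν i (f := -|f|) (g := f) (fun y => neg_abs_le (f y)) x
  simpa using this

lemma lopLin_lopLin_self (i : Fin n) (f : Cfg σ n → ℝ) :
    lopLin ν i (lopLin ν i f) = -lopLin ν i f := by
  simp only [lopLin_apply, map_sub, popLin_popLin hν]; abel

lemma ip_lopLin_lopLin (i : Fin n) (f g : Cfg σ n → ℝ) :
    ip ν (lopLin ν i f) (lopLin ν i g) = -ip ν f (lopLin ν i g) := by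
  rw [ip_lopLin_comm, lopLin_lopLin_self hν, map_neg]

lemma ip_self_nonneg (f : Cfg σ n → ℝ) : 0 ≤ ip ν f f := by
  rw [ip_apply]
  exact Finset.sum_nonneg fun x _ => mul_nonneg (hν.1 x).le (mul_self_nonneg _)

lemma two_mul_ip_le (f g : Cfg σ n → ℝ) : 2 * ip ν f g ≤ ip ν f f + ip ν g g := by
  have h := ip_self_nonneg hν (f - g)
  simp only [map_sub, LinearMap.sub_apply, ip_comm ν g f] at h
  linarith

lemma ip_lopLin_self (i : Fin n) (f : Cfg σ n → ℝ) :
    ip ν (lopLin ν i f) (lopLin ν i f) = ip ν f f - ip ν (popLin ν i f) (popLin ν i f) := by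
  simp only [lopLin_apply, map_sub, LinearMap.sub_apply]
  have h1 : ip ν (popLin ν i f) (popLin ν i f) = ip ν f (popLin ν i f) := by
    rw [ip_popLin_comm, popLin_popLin hν]
  rw [ip_comm ν (popLin ν i f) f]
  linarith

lemma ip_lopLin_self_le (i : Fin n) (f : Cfg σ n → ℝ) :
    ip ν (lopLin ν i f) (lopLin ν i f) ≤ ip ν f f := by
  rw [ip_lopLin_self hν]
  linarith [ip_self_nonneg hν (popLin ν i f)]

lemma ip_lopLin_abs_le (i : Fin n) (f : Cfg σ n → ℝ) :
    ip ν (lopLin ν i |f|) (lopLin ν i |f|) ≤ ip ν (lopLin ν i f) (lopLin ν i f) := by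
  rw [ip_lopLin_self hν, ip_lopLin_self hν]
  have h1 : ip ν |f| |f| = ip ν f f := by simp [ip_apply]
  have h2 : ip ν (popLin ν i f) (popLin ν i f) ≤ ip ν (popLin ν i |f|) (popLin ν i |f|) := by
    simp only [ip_apply]
    refine Finset.sum_le_sum fun x _ => mul_le_mul_of_nonneg_left ?_ (hν.1 x).le
    rw [← abs_mul_abs_self (popLin ν i f x)]
    have := abs_popLin_le hν i f x
    exact mul_self_le_mul_self (abs_nonneg _) this
  linarith

lemma ip_one_popLin (i : Fin n) (f : Cfg σ n → ℝ) : ip ν 1 (popLin ν i f) = ip ν 1 f := by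
  rw [← ip_popLin_comm, popLin_one hν]

lemma normOne_add_le (f g : Cfg σ n → ℝ) : normOne ν (f + g) ≤ normOne ν f + normOne ν g := by
  simp only [normOne, expct, ← Finset.sum_add_distrib, ← mul_add]
  exact Finset.sum_le_sum fun x _ => mul_le_mul_of_nonneg_left (abs_add_le _ _) (hν.1 x).le

lemma normOne_sum_le {ι : Type*} (s : Finset ι) (f : ι → Cfg σ n → ℝ) :
    normOne ν (∑ j ∈ s, f j) ≤ ∑ j ∈ s, normOne ν (f j) :=
  Finset.le_sum_of_subadditive (normOne ν) (by simp [normOne, expct]) (normOne_add_le hν) s f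

lemma normOne_popLin_le (i : Fin n) (f : Cfg σ n → ℝ) :
    normOne ν (popLin ν i f) ≤ normOne ν f := by
  rw [normOne_eq_ip ν f, ← ip_one_popLin hν i]
  simp only [normOne, expct, ip_apply, Pi.one_apply, one_mul]
  exact Finset.sum_le_sum fun x _ => mul_le_mul_of_nonneg_left (abs_popLin_le hν i f x) (hν.1 x).le

lemma normOne_lopLin_le (i : Fin n) (f : Cfg σ n → ℝ) :
    normOne ν (lopLin ν i f) ≤ 2 * normOne ν f := by
  have h := normOne_add_le hν (popLin ν i f) (-f)
  have h' : normOne ν (-f) = normOne ν f := by simp [normOne]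
  rw [lopLin_apply, sub_eq_add_neg]
  linarith [normOne_popLin_le hν i f]

end

lemma popLin_commute {ν : Cfg σ n → ℝ} {G : SimpleGraph (Fin n)} (hG : IsMRF ν G)
    {i j : Fin n} (hij : ¬ G.Adj i j) (f : Cfg σ n → ℝ) :
    popLin ν i (popLin ν j f) = popLin ν j (popLin ν i f) := by
  rcases eq_or_ne i j with rfl | hne
  · rfl
  have aux : ∀ k l : Fin n, ¬ G.Adj k l → ∀ (x : Cfg σ n) (a c : σ),
      condProb ν k (Function.update x l a) c = condProb ν k x c := by
    intro k l hkl x a c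
    refine hG k _ _ (fun m hm => ?_) c
    have : m ≠ l := by rintro rfl; exact hkl hm
    simp [this]
  ext x
  simp only [popLin_apply, Pop_eq_sum_condProb, aux i j hij, aux j i (fun h => hij h.symm),
    Finset.mul_sum]
  rw [Finset.sum_comm]
  refine Finset.sum_congr rfl fun a _ => Finset.sum_congr rfl fun c _ => ?_
  rw [Function.update_comm hne]; ring

lemma lopLin_commute {ν : Cfg σ n → ℝ} {G : SimpleGraph (Fin n)} (hG : IsMRF ν G)
    {i j : Fin n} (hij : ¬ G.Adj i j) (f : Cfg σ n → ℝ) :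
    lopLin ν i (lopLin ν j f) = lopLin ν j (lopLin ν i f) := by
  simp only [lopLin_apply, map_sub, popLin_commute hG hij]; abel

/-- The generator `∑ i, L_i` of the continuous-time Glauber dynamics. -/
def genLin (ν : Cfg σ n → ℝ) : (Cfg σ n → ℝ) →ₗ[ℝ] (Cfg σ n → ℝ) := ∑ i, lopLin ν i

/-- The transition operator of the discrete-time Glauber dynamics. -/
def stepLin (ν : Cfg σ n → ℝ) : (Cfg σ n → ℝ) →ₗ[ℝ] (Cfg σ n → ℝ) :=
  LinearMap.id + (n : ℝ)⁻¹ • genLin ν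

/-- The Dirichlet form `∑ i, E[(L_i f)²]`. -/
def dirichlet (ν f : Cfg σ n → ℝ) : ℝ := ∑ i, ip ν (lopLin ν i f) (lopLin ν i f)

lemma genLin_apply (ν f : Cfg σ n → ℝ) : genLin ν f = ∑ i, lopLin ν i f := by
  simp [genLin]

lemma stepLin_apply (ν f : Cfg σ n → ℝ) : stepLin ν f = f + (n : ℝ)⁻¹ • genLin ν f := rfl

lemma varnc_eq {ν : Cfg σ n → ℝ} (hν : IsProb ν) (f : Cfg σ n → ℝ) :
    varnc ν f = ip ν f f - ip ν 1 f ^ 2 := by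
  have h0 : expct ν f = ip ν 1 f := by simp [expct, ip_apply]
  have h1 : (fun x => (f x - expct ν f) ^ 2) = fun x => (f - ip ν 1 f • 1) x ^ 2 := by
    ext x; simp [h0]
  have h2 : ip ν (1 : Cfg σ n → ℝ) 1 = 1 := by simp [ip_apply, hν.2]
  rw [varnc, h1, expct_sq]
  simp only [map_sub, map_smul, LinearMap.sub_apply, LinearMap.smul_apply, smul_eq_mul, h2,
    ip_comm ν f 1]
  ring

section

variable {ν : Cfg σ n → ℝ} (hν : IsProb ν)

include hν

lemma varnc_nonneg (f : Cfg σ n → ℝ) : 0 ≤ varnc ν f :=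
  Finset.sum_nonneg fun x _ => mul_nonneg (hν.1 x).le (sq_nonneg _)

lemma dirichlet_nonneg (f : Cfg σ n → ℝ) : 0 ≤ dirichlet ν f :=
  Finset.sum_nonneg fun _ _ => ip_self_nonneg hν _

lemma dirichlet_eq (f : Cfg σ n → ℝ) : dirichlet ν f = -ip ν f (genLin ν f) := by
  simp only [dirichlet, ip_lopLin_lopLin hν, genLin_apply, map_sum, Finset.sum_neg_distrib]

lemma ip_one_genLin (f : Cfg σ n → ℝ) : ip ν 1 (genLin ν f) = 0 := by
  rw [genLin_apply, map_sum]
  exact Finset.sum_eq_zero fun i _ => by rw [lopLin_apply, map_sub, ip_one_popLin hν, sub_self]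

lemma ip_one_stepLin (f : Cfg σ n → ℝ) : ip ν 1 (stepLin ν f) = ip ν 1 f := by
  simp [stepLin_apply, ip_one_genLin hν]

lemma ip_genLin_self_le (f : Cfg σ n → ℝ) :
    ip ν (genLin ν f) (genLin ν f) ≤ n * dirichlet ν f := by
  simp only [dirichlet, ip_apply, genLin_apply, Finset.sum_apply]
  rw [Finset.sum_comm, Finset.mul_sum]
  refine Finset.sum_le_sum fun x _ => ?_
  have h := sq_sum_le_card_mul_sum_sq (s := Finset.univ) (f := fun i => lopLin ν i f x)
  rw [Finset.card_univ, Fintype.card_fin] at h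
  simp only [sq] at h
  rw [← Finset.mul_sum, mul_left_comm (n : ℝ)]
  exact mul_le_mul_of_nonneg_left h (hν.1 x).le

lemma dirichlet_le (f : Cfg σ n → ℝ) : dirichlet ν f ≤ n * ip ν f f := by
  have h := Finset.sum_le_sum fun i (_ : i ∈ Finset.univ) => ip_lopLin_self_le hν i f
  simpa [dirichlet] using h

lemma varnc_sub_varnc_stepLin (hn : 1 ≤ n) (f : Cfg σ n → ℝ) :
    varnc ν f - varnc ν (stepLin ν f) =
      2 / n * dirichlet ν f - ip ν (genLin ν f) (genLin ν f) / n ^ 2 := by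
  have hn' : (n : ℝ) ≠ 0 := by positivity
  rw [varnc_eq hν, varnc_eq hν, ip_one_stepLin hν, dirichlet_eq hν, stepLin_apply]
  simp only [map_add, map_smul, LinearMap.add_apply, LinearMap.smul_apply, smul_eq_mul,
    ip_comm ν (genLin ν f) f]
  field_simp
  ring

lemma varnc_sub_varnc_stepLin_le (hn : 1 ≤ n) (f : Cfg σ n → ℝ) :
    varnc ν f - varnc ν (stepLin ν f) ≤ 2 / n * dirichlet ν f := by
  rw [varnc_sub_varnc_stepLin hν hn]
  have := ip_self_nonneg hν (genLin ν f)
  have : 0 ≤ ip ν (genLin ν f) (genLin ν f) / n ^ 2 := by positivity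
  linarith

lemma le_varnc_sub_varnc_stepLin (hn : 1 ≤ n) (f : Cfg σ n → ℝ) :
    dirichlet ν f / n ≤ varnc ν f - varnc ν (stepLin ν f) := by
  rw [varnc_sub_varnc_stepLin hν hn]
  have hn' : (0 : ℝ) < n := by positivity
  have : ip ν (genLin ν f) (genLin ν f) / n ^ 2 ≤ dirichlet ν f / n := by
    rw [div_le_div_iff₀ (by positivity) hn']
    nlinarith [ip_genLin_self_le hν f]
  have h2 : 2 / n * dirichlet ν f = 2 * (dirichlet ν f / n) := by ring
  linarith

lemma ip_genLin_self_le_dirichlet_sub (hn : 1 ≤ n) (f : Cfg σ n → ℝ) :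
    ip ν (genLin ν f) (genLin ν f) ≤ n * (dirichlet ν f - dirichlet ν (stepLin ν f)) := by
  have hn' : (n : ℝ) ≠ 0 := by positivity
  have hsymm : ∀ g h, ip ν (genLin ν g) h = ip ν g (genLin ν h) := by
    intro g h
    simp only [genLin_apply, map_sum, LinearMap.sum_apply, ip_lopLin_comm]
  have h := dirichlet_le hν (genLin ν f)
  rw [dirichlet_eq hν] at h
  have h1 : dirichlet ν f - dirichlet ν (stepLin ν f) =
      2 / n * ip ν (genLin ν f) (genLin ν f)
        + ip ν (genLin ν f) (genLin ν (genLin ν f)) / n ^ 2 := by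
    rw [dirichlet_eq hν, dirichlet_eq hν, stepLin_apply]
    simp only [map_add, map_smul, LinearMap.add_apply, LinearMap.smul_apply, smul_eq_mul,
      ← hsymm f]
    field_simp
    ring
  rw [h1]
  have h2 : (n : ℝ) * (2 / n * ip ν (genLin ν f) (genLin ν f)
        + ip ν (genLin ν f) (genLin ν (genLin ν f)) / n ^ 2) =
      2 * ip ν (genLin ν f) (genLin ν f)
        + ip ν (genLin ν f) (genLin ν (genLin ν f)) / n := by
    field_simp
  rw [h2]
  have h3 : -ip ν (genLin ν f) (genLin ν (genLin ν f)) / n ≤ ip ν (genLin ν f) (genLin ν f) := by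
    rw [div_le_iff₀ (by positivity)]; linarith
  rw [neg_div] at h3
  linarith

variable {G : SimpleGraph (Fin n)} {Δ : ℕ}

lemma ip_lopLin_lopLin_le (hG : IsMRF ν G) (i j : Fin n) (f : Cfg σ n → ℝ) :
    ip ν (lopLin ν j (lopLin ν i f)) (lopLin ν j (lopLin ν i f)) ≤
      ip ν (lopLin ν i f) (lopLin ν j f) + if G.Adj i j then
        2 * (ip ν (lopLin ν i f) (lopLin ν i f) + ip ν (lopLin ν j f) (lopLin ν j f)) else 0 := by
  by_cases h : G.Adj i j
  · rw [if_pos h]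
    have h1 := ip_lopLin_self_le hν j (lopLin ν i f)
    have h2 := two_mul_ip_le hν (lopLin ν i f) (-lopLin ν j f)
    simp only [map_neg, LinearMap.neg_apply, neg_neg] at h2
    have h3 := ip_self_nonneg hν (lopLin ν i f)
    have h4 := ip_self_nonneg hν (lopLin ν j f)
    linarith
  · rw [if_neg h, add_zero, ip_lopLin_lopLin hν, ← lopLin_commute hG h, ← ip_lopLin_comm,
      lopLin_lopLin_self hν, map_neg, LinearMap.neg_apply, neg_neg]

lemma sum_dirichlet_lopLin_le (hG : IsMRF ν G) (hdeg : MaxDegLE G Δ) (f : Cfg σ n → ℝ) :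
    ∑ i, dirichlet ν (lopLin ν i f) ≤
      ip ν (genLin ν f) (genLin ν f) + 4 * Δ * dirichlet ν f := by
  have hcard : ∀ i, ∑ j, (if G.Adj i j then (1 : ℝ) else 0) ≤ Δ := by
    intro i
    rw [Finset.sum_boole]
    exact_mod_cast hdeg i
  have hsum : ∑ i, ∑ j, (if G.Adj i j then ip ν (lopLin ν i f) (lopLin ν i f) else 0) ≤
      Δ * dirichlet ν f := by
    rw [dirichlet, Finset.mul_sum]
    refine Finset.sum_le_sum fun i _ => ?_
    refine le_of_eq_of_le ?_ (mul_le_mul_of_nonneg_right (hcard i) (ip_self_nonneg hν _))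
    rw [Finset.sum_mul]
    exact Finset.sum_congr rfl fun j _ => by split_ifs <;> simp
  have hsum' : ∑ i, ∑ j, (if G.Adj i j then ip ν (lopLin ν j f) (lopLin ν j f) else 0) ≤
      Δ * dirichlet ν f := by
    rw [Finset.sum_comm]
    simpa only [G.adj_comm] using hsum
  have hgen : ∑ i, ∑ j, ip ν (lopLin ν i f) (lopLin ν j f) = ip ν (genLin ν f) (genLin ν f) := by
    simp only [genLin_apply, map_sum, LinearMap.sum_apply]
    exact Finset.sum_comm
  calc ∑ i, dirichlet ν (lopLin ν i f)
      ≤ ∑ i, ∑ j, (ip ν (lopLin ν i f) (lopLin ν j f) + if G.Adj i j then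
        2 * (ip ν (lopLin ν i f) (lopLin ν i f) + ip ν (lopLin ν j f) (lopLin ν j f)) else 0) :=
        Finset.sum_le_sum fun i _ => Finset.sum_le_sum fun j _ => ip_lopLin_lopLin_le hν hG i j f
    _ = ip ν (genLin ν f) (genLin ν f)
        + (2 * ∑ i, ∑ j, (if G.Adj i j then ip ν (lopLin ν i f) (lopLin ν i f) else 0)
        + 2 * ∑ i, ∑ j, (if G.Adj i j then ip ν (lopLin ν j f) (lopLin ν j f) else 0)) := by
      rw [← hgen]
      simp only [Finset.mul_sum, ← Finset.sum_add_distrib]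
      refine Finset.sum_congr rfl fun i _ => Finset.sum_congr rfl fun j _ => ?_
      split_ifs <;> ring
    _ ≤ _ := by linarith

lemma normOne_lopLin_popLin_le (hG : IsMRF ν G) (i j : Fin n) (f : Cfg σ n → ℝ) :
    normOne ν (lopLin ν i (popLin ν j f)) ≤ normOne ν (lopLin ν i f) +
      if G.Adj i j then 2 * normOne ν (lopLin ν j f) else 0 := by
  by_cases h : G.Adj i j
  · rw [if_pos h]
    have h1 : popLin ν j f = f + lopLin ν j f := by rw [lopLin_apply]; abel
    rw [h1, map_add]
    exact (normOne_add_le hν _ _).trans (by gcongr; exact normOne_lopLin_le hν _ _)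
  · have h1 : lopLin ν i (popLin ν j f) = popLin ν j (lopLin ν i f) := by
      simp only [lopLin_apply, map_sub, popLin_commute hG h]
    rw [if_neg h, add_zero, h1]
    exact normOne_popLin_le hν _ _

lemma normOne_lopLin_stepLin_le (hn : 1 ≤ n) (hG : IsMRF ν G) (hdeg : MaxDegLE G Δ)
    {f : Cfg σ n → ℝ} {m : ℝ} (hm0 : 0 ≤ m) (hm : ∀ i, normOne ν (lopLin ν i f) ≤ m) (i : Fin n) :
    normOne ν (lopLin ν i (stepLin ν f)) ≤ (1 + 2 * Δ / n) * m := by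
  have hn' : (0 : ℝ) < n := by positivity
  have h1 : stepLin ν f = (n : ℝ)⁻¹ • ∑ j, popLin ν j f := by
    rw [stepLin_apply, genLin_apply]
    simp only [lopLin_apply, Finset.sum_sub_distrib, Finset.sum_const, Finset.card_univ,
      Fintype.card_fin, smul_sub]
    rw [← Nat.cast_smul_eq_nsmul ℝ, inv_smul_smul₀ hn'.ne']; abel
  rw [h1, map_smul, map_sum, normOne_smul, abs_of_pos (inv_pos.2 hn'), inv_mul_le_iff₀ hn']
  calc normOne ν (∑ j, lopLin ν i (popLin ν j f))
      ≤ ∑ j, normOne ν (lopLin ν i (popLin ν j f)) := normOne_sum_le hν _ _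
    _ ≤ ∑ j, (m + (if G.Adj i j then 1 else 0) * (2 * m)) := by
      refine Finset.sum_le_sum fun j _ => (normOne_lopLin_popLin_le hν hG i j f).trans ?_
      have := hm i
      have := hm j
      split_ifs <;> linarith
    _ = n * m + (Finset.univ.filter fun j => G.Adj i j).card * (2 * m) := by
      rw [Finset.sum_add_distrib, ← Finset.sum_mul, Finset.sum_boole]; simp
    _ ≤ n * m + Δ * (2 * m) := by
      have : ((Finset.univ.filter fun j => G.Adj i j).card : ℝ) ≤ Δ := by exact_mod_cast hdeg i
      gcongr
    _ = n * ((1 + 2 * Δ / n) * m) := by field_simp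

lemma normOne_lopLin_stepLin_pow_le (hn : 1 ≤ n) (hG : IsMRF ν G) (hdeg : MaxDegLE G Δ)
    {f : Cfg σ n → ℝ} {m : ℝ} (hm0 : 0 ≤ m) (hm : ∀ i, normOne ν (lopLin ν i f) ≤ m)
    (t : ℕ) (i : Fin n) :
    normOne ν (lopLin ν i ((stepLin ν ^ t) f)) ≤ (1 + 2 * Δ / n) ^ t * m := by
  induction t generalizing i with
  | zero => simpa using hm i
  | succ t ih =>
    rw [pow_succ', pow_succ', mul_assoc]
    exact normOne_lopLin_stepLin_le hν hn hG hdeg (by positivity) ih i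

end

section

variable {ν : Cfg σ n → ℝ} (hν : IsProb ν)

include hν

/-- Entropy lower bound `‖u‖₂² log (‖u‖₂² / ‖u‖₁²) ≤ Ent (u²)`. -/
lemma ip_mul_log_le_entFun {u : Cfg σ n → ℝ} {m : ℝ} (hm : 0 < m) (hum : normOne ν u ≤ m)
    (hA : 0 < ip ν u u) :
    ip ν u u * Real.log (ip ν u u / m ^ 2) ≤ entFun ν (fun x => u x ^ 2) := by
  set A := ip ν u u with hAdef
  set c := m / A with hc
  have hc0 : 0 < c := by positivity
  have hpt : ∀ t : ℝ,
      2 * t ^ 2 - 2 * |t| / c - 2 * t ^ 2 * Real.log c ≤ t ^ 2 * Real.log (t ^ 2) := by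
    intro t
    rcases eq_or_ne t 0 with rfl | ht
    · simp
    · have ht' : 0 < |t| := abs_pos.2 ht
      have h := Real.one_sub_inv_le_log_of_pos (mul_pos hc0 ht')
      rw [Real.log_mul hc0.ne' ht'.ne', Real.log_abs] at h
      have h2 := mul_le_mul_of_nonneg_left h (by positivity : 0 ≤ 2 * t ^ 2)
      have h3 : t ^ 2 * (c * |t|)⁻¹ = |t| / c := by
        rw [← sq_abs]; field_simp
      rw [Real.log_pow]
      push_cast
      have h4 : 2 * t ^ 2 * (1 - (c * |t|)⁻¹) = 2 * t ^ 2 - 2 * |t| / c := by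
        rw [mul_sub, mul_assoc 2 (t ^ 2) (c * |t|)⁻¹, h3]; ring
      rw [h4] at h2
      linarith
  have hsum : 2 * A - 2 * normOne ν u / c - 2 * A * Real.log c ≤
      expct ν (fun x => u x ^ 2 * Real.log (u x ^ 2)) := by
    rw [hAdef, ← expct_sq]
    have h := Finset.sum_le_sum fun x (_ : x ∈ Finset.univ) =>
      mul_le_mul_of_nonneg_left (hpt (u x)) (hν.1 x).le
    refine le_of_eq_of_le ?_ h
    simp only [expct, normOne, Finset.mul_sum, Finset.sum_mul, Finset.sum_div,
      ← Finset.sum_sub_distrib]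
    exact Finset.sum_congr rfl fun x _ => by ring
  have h1 : normOne ν u / c ≤ A := by
    rw [div_le_iff₀ hc0, hc, mul_div_cancel₀ _ hA.ne']; exact hum
  have h2 : Real.log c = Real.log m - Real.log A := Real.log_div hm.ne' hA.ne'
  have h3 : Real.log (A / m ^ 2) = Real.log A - 2 * Real.log m := by
    rw [Real.log_div hA.ne' (by positivity), Real.log_pow]; norm_num
  rw [entFun, expct_sq, ← hAdef, h3]
  rw [h2, mul_div_assoc] at hsum
  linarith

lemma entFun_sq_le_dirichlet {ρ : ℝ} (hL : LogSobolev ν ρ) (u : Cfg σ n → ℝ) :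
    ρ * entFun ν (fun x => u x ^ 2) ≤ 2 * dirichlet ν u := by
  refine (hL (fun x => u x ^ 2) fun x => sq_nonneg _).trans ?_
  simp only [Real.sqrt_sq_eq_abs]
  gcongr
  rw [dirichlet]
  refine Finset.sum_le_sum fun i _ => ?_
  rw [expct_sq]
  exact ip_lopLin_abs_le hν i u

lemma poincare {ρ : ℝ} (hρ : 0 < ρ) (hL : LogSobolev ν ρ) (f : Cfg σ n → ℝ) :
    ρ * varnc ν f ≤ 2 * dirichlet ν f := by
  set C : ℝ := 1 + ∑ x, |f x| with hC
  set u : Cfg σ n → ℝ := f + C • 1 with hu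
  have hupos : ∀ x, 0 < u x := by
    intro x
    have h1 := Finset.single_le_sum (f := fun x => |f x|) (fun y _ => abs_nonneg _)
      (Finset.mem_univ x)
    have h2 := neg_abs_le (f x)
    simp only [hu, Pi.add_apply, Pi.smul_apply, Pi.one_apply, smul_eq_mul, mul_one]
    linarith
  have hone : ip ν (1 : Cfg σ n → ℝ) 1 = 1 := by simp [ip_apply, hν.2]
  have hvar : varnc ν u = varnc ν f := by
    rw [varnc_eq hν, varnc_eq hν, hu]
    simp only [map_add, map_smul, LinearMap.add_apply, LinearMap.smul_apply, smul_eq_mul, hone,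
      ip_comm ν f 1]
    ring
  have hdir : dirichlet ν u = dirichlet ν f := by
    have : ∀ i, lopLin ν i u = lopLin ν i f := by
      intro i
      simp [hu, lopLin_apply, popLin_one hν]
    simp only [dirichlet, this]
  have habs : |u| = u := abs_of_nonneg fun x => (hupos x).le
  have hne : (Finset.univ : Finset (Cfg σ n)).Nonempty := by
    by_contra h
    have h1 := hν.2
    rw [Finset.not_nonempty_iff_eq_empty.1 h] at h1
    simp at h1
  have hm : 0 < ip ν 1 u := by
    rw [ip_apply]
    exact Finset.sum_pos (fun x _ => mul_pos (hν.1 x) (by simpa using hupos x)) hne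
  have hA : 0 < ip ν u u := by
    rw [ip_apply]
    exact Finset.sum_pos (fun x _ => mul_pos (hν.1 x) (mul_pos (hupos x) (hupos x))) hne
  have hent := ip_mul_log_le_entFun hν hm (by rw [normOne_eq_ip, habs]) hA
  have hlog := Real.one_sub_inv_le_log_of_pos
    (div_pos hA (by positivity : 0 < ip ν 1 u ^ 2))
  have h1 := mul_le_mul_of_nonneg_left hlog hA.le
  have h2 : ip ν u u * (1 - (ip ν u u / ip ν 1 u ^ 2)⁻¹) = varnc ν u := by
    rw [varnc_eq hν]; field_simp
  rw [← hvar, ← hdir]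
  refine le_trans ?_ (entFun_sq_le_dirichlet hν hL u)
  gcongr
  linarith

lemma logSobolev_normOne {ρ : ℝ} (hρ : 0 < ρ) (hL : LogSobolev ν ρ) {u : Cfg σ n → ℝ} {m θ : ℝ}
    (hm : 0 < m) (hθ : 0 < θ) (hum : normOne ν u ≤ m) :
    ρ * (ip ν u u * Real.log (θ / m ^ 2) - θ) ≤ 2 * dirichlet ν u := by
  rcases (ip_self_nonneg hν u).eq_or_lt with hA | hA
  · rw [← hA]
    have := dirichlet_nonneg hν u
    have := mul_pos hρ hθ
    linarith
  · refine le_trans ?_ (entFun_sq_le_dirichlet hν hL u)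
    gcongr
    refine le_trans ?_ (ip_mul_log_le_entFun hν hm hum hA)
    have h := Real.one_sub_inv_le_log_of_pos (div_pos hA hθ)
    have h1 := mul_le_mul_of_nonneg_left h hA.le
    have h2 : ip ν u u * (1 - (ip ν u u / θ)⁻¹) = ip ν u u - θ := by field_simp
    rw [Real.log_div hA.ne' hθ.ne', h2] at h1
    rw [Real.log_div hA.ne' (by positivity), Real.log_div hθ.ne' (by positivity)]
    linarith

lemma varnc_stepLin_pow_le {ρ : ℝ} (hρ : 0 < ρ) (hρ1 : ρ ≤ 1) (hn : 1 ≤ n) (hL : LogSobolev ν ρ)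
    (f : Cfg σ n → ℝ) (t : ℕ) :
    varnc ν ((stepLin ν ^ t) f) ≤ (1 - ρ / (2 * n)) ^ t * varnc ν f := by
  have hn1 : (1 : ℝ) ≤ n := by exact_mod_cast hn
  have hnn : 0 ≤ 1 - ρ / (2 * n) := by
    rw [sub_nonneg, div_le_one (by positivity)]; linarith
  induction t with
  | zero => simp
  | succ t ih =>
    rw [pow_succ', pow_succ', mul_assoc]
    refine le_trans ?_ (mul_le_mul_of_nonneg_left ih hnn)
    set g := (stepLin ν ^ t) f
    have h1 := le_varnc_sub_varnc_stepLin hν hn g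
    have h2 := poincare hν hρ hL g
    have h3 : ρ / (2 * n) * varnc ν g ≤ dirichlet ν g / n := by
      rw [div_mul_eq_mul_div, div_le_div_iff₀ (by positivity) (by positivity)]
      nlinarith
    change varnc ν (stepLin ν g) ≤ _
    linarith

lemma le_sum_dirichlet (hn : 1 ≤ n) (f : Cfg σ n → ℝ) (N : ℕ) :
    n / 2 * (varnc ν f - varnc ν ((stepLin ν ^ N) f)) ≤
      ∑ t ∈ Finset.range N, dirichlet ν ((stepLin ν ^ t) f) := by
  have hn' : (0 : ℝ) < n := by positivity
  have h := Finset.sum_range_sub' (fun t => varnc ν ((stepLin ν ^ t) f)) N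
  simp only [pow_zero, Module.End.one_apply] at h
  rw [← h, Finset.mul_sum]
  refine Finset.sum_le_sum fun t _ => ?_
  have h1 := varnc_sub_varnc_stepLin_le hν hn ((stepLin ν ^ t) f)
  rw [pow_succ']
  refine (mul_le_mul_of_nonneg_left h1 (by positivity)).trans (le_of_eq ?_)
  field_simp

lemma dirichlet_stepLin_pow_le (hn : 1 ≤ n) (f : Cfg σ n → ℝ) (t : ℕ) :
    dirichlet ν ((stepLin ν ^ t) f) ≤ dirichlet ν f := by
  induction t with
  | zero => simp
  | succ t ih =>
    refine le_trans ?_ ih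
    rw [pow_succ']
    have h := (ip_self_nonneg hν _).trans
      (ip_genLin_self_le_dirichlet_sub hν hn ((stepLin ν ^ t) f))
    have := nonneg_of_mul_nonneg_right h (by positivity : (0 : ℝ) < n)
    exact sub_nonneg.1 this

lemma sum_ip_genLin_le (hn : 1 ≤ n) (f : Cfg σ n → ℝ) (N : ℕ) :
    ∑ t ∈ Finset.range N, ip ν (genLin ν ((stepLin ν ^ t) f)) (genLin ν ((stepLin ν ^ t) f)) ≤
      n * dirichlet ν f := by
  have h := Finset.sum_range_sub' (fun t => dirichlet ν ((stepLin ν ^ t) f)) N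
  simp only [pow_zero, Module.End.one_apply] at h
  calc _ ≤ ∑ t ∈ Finset.range N, n * (dirichlet ν ((stepLin ν ^ t) f)
        - dirichlet ν ((stepLin ν ^ (t + 1)) f)) := by
        refine Finset.sum_le_sum fun t _ => ?_
        rw [pow_succ']
        exact ip_genLin_self_le_dirichlet_sub hν hn _
    _ = n * (dirichlet ν f - dirichlet ν ((stepLin ν ^ N) f)) := by rw [← Finset.mul_sum, h]
    _ ≤ n * dirichlet ν f := by
        have := dirichlet_nonneg hν ((stepLin ν ^ N) f)
        gcongr
        linarith

/-- Talagrand-type inequality along the discrete-time Glauber dynamics. -/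
lemma sum_dirichlet_mul_log_le {ρ : ℝ} (hρ : 0 < ρ) (hn : 1 ≤ n) (hL : LogSobolev ν ρ)
    {G : SimpleGraph (Fin n)} {Δ : ℕ} (hG : IsMRF ν G) (hdeg : MaxDegLE G Δ)
    {f : Cfg σ n → ℝ} {N : ℕ} {m θ : ℝ} (hm : 0 < m) (hθ : 0 < θ)
    (hfm : ∀ t < N, ∀ i, normOne ν (lopLin ν i ((stepLin ν ^ t) f)) ≤ m) :
    ρ * ((∑ t ∈ Finset.range N, dirichlet ν ((stepLin ν ^ t) f)) * Real.log (θ / m ^ 2)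
      - N * n * θ) ≤ 2 * ((n + 4 * Δ * N) * dirichlet ν f) := by
  have hstep : ∀ t ∈ Finset.range N,
      ρ * (dirichlet ν ((stepLin ν ^ t) f) * Real.log (θ / m ^ 2) - n * θ) ≤
        2 * (ip ν (genLin ν ((stepLin ν ^ t) f)) (genLin ν ((stepLin ν ^ t) f))
          + 4 * Δ * dirichlet ν f) := by
    intro t ht
    have h := Finset.sum_le_sum fun i (_ : i ∈ Finset.univ) =>
      logSobolev_normOne hν hρ hL hm hθ (hfm t (Finset.mem_range.1 ht) i)
    rw [← Finset.mul_sum, ← Finset.mul_sum, Finset.sum_sub_distrib, ← Finset.sum_mul,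
      Finset.sum_const, Finset.card_univ, Fintype.card_fin, nsmul_eq_mul] at h
    refine h.trans ?_
    have h1 := sum_dirichlet_lopLin_le hν hG hdeg ((stepLin ν ^ t) f)
    have h2 := dirichlet_stepLin_pow_le hν hn f t
    have h3 : 4 * Δ * dirichlet ν ((stepLin ν ^ t) f) ≤ 4 * Δ * dirichlet ν f := by gcongr
    linarith
  have h := Finset.sum_le_sum hstep
  rw [← Finset.mul_sum, ← Finset.mul_sum, Finset.sum_sub_distrib, ← Finset.sum_mul,
    Finset.sum_const, Finset.card_range, nsmul_eq_mul, Finset.sum_add_distrib,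
    Finset.sum_const, Finset.card_range, nsmul_eq_mul] at h
  have h1 := sum_ip_genLin_le hν hn f N
  rw [mul_assoc (N : ℝ)]
  linarith

variable {f : Cfg σ n → ℝ} (hf : ∀ x, f x = 0 ∨ f x = 1)

include hf

lemma abs_lopLin_le (i : Fin n) (x : Cfg σ n) :
    |lopLin ν i f x| ≤ if ∃ a : σ, f (Function.update x i a) ≠ f x then 1 else 0 := by
  have h0 : ∀ y, 0 ≤ f y := fun y => by rcases hf y with h | h <;> simp [h]
  have h1 : ∀ y, f y ≤ 1 := fun y => by rcases hf y with h | h <;> simp [h]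
  rw [lopLin_apply, Pi.sub_apply]
  split_ifs with h
  · have h2 := popLin_mono hν i (f := 0) h0 x
    have h3 := popLin_mono hν i (g := 1) h1 x
    rw [popLin_one hν] at h3
    rw [map_zero] at h2
    simp only [Pi.zero_apply, Pi.one_apply] at h2 h3
    rw [abs_le]
    constructor <;> linarith [h0 x, h1 x]
  · push Not at h
    rw [popLin_of_const_on_fibre hν i f x, sub_self, abs_zero]
    intro y hy
    rw [← h (y i)]
    congr 1
    ext j
    by_cases hj : j = i
    · subst hj; simp
    · simp [hj, mem_fibre.1 hy j hj]

lemma normOne_lopLin_le_influence (i : Fin n) : normOne ν (lopLin ν i f) ≤ influence ν f i := by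
  rw [influence, Finset.sum_filter]
  refine Finset.sum_le_sum fun x _ => ?_
  refine (mul_le_mul_of_nonneg_left (abs_lopLin_le hν hf i x) (hν.1 x).le).trans (le_of_eq ?_)
  split_ifs <;> simp

lemma ip_lopLin_le_normOne (i : Fin n) :
    ip ν (lopLin ν i f) (lopLin ν i f) ≤ normOne ν (lopLin ν i f) := by
  refine Finset.sum_le_sum fun x _ => mul_le_mul_of_nonneg_left ?_ (hν.1 x).le
  rw [← abs_mul_abs_self]
  refine mul_le_of_le_one_left (abs_nonneg _) ((abs_lopLin_le hν hf i x).trans ?_)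
  split_ifs <;> simp

lemma varnc_le_one : varnc ν f ≤ 1 := by
  rw [varnc_eq hν]
  have h : ip ν f f ≤ 1 := by
    rw [← hν.2, ip_apply]
    refine Finset.sum_le_sum fun x _ => ?_
    rcases hf x with h | h <;> simp [h, (hν.1 x).le]
  linarith [sq_nonneg (ip ν 1 f)]

end

lemma influence_nonneg {ν : Cfg σ n → ℝ} (hν : IsProb ν) (f : Cfg σ n → ℝ) (i : Fin n) :
    0 ≤ influence ν f i :=
  Finset.sum_nonneg fun x _ => (hν.1 x).le

/-- The logarithmic gain in the KKL argument, with `δ = α V log n / n` the influence bound. -/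
lemma half_log_add_le_log {α V C r x : ℝ} (hα : 0 < α) (hV : 0 < V) (hV1 : V ≤ 1) (hC : 0 < C)
    (hr : 1 ≤ r) (hx : 0 < x) (hlog : 0 < Real.log x) (hα' : α ≤ Real.exp (-4) / (4 * r * C)) :
    Real.log x / 2 + 8 ≤
      Real.log (V / (r * x) / (C * (α * V * Real.log x / x)) ^ 2) := by
  have hr0 : 0 < r := by linarith
  have h1 : Real.log (V / (r * x) / (C * (α * V * Real.log x / x)) ^ 2) =
      Real.log V - (Real.log r + Real.log x) - 2 * (Real.log C +
        (Real.log α + Real.log V + Real.log (Real.log x) - Real.log x)) := by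
    rw [Real.log_div (by positivity) (by positivity), Real.log_pow,
      Real.log_div hV.ne' (by positivity), Real.log_mul hr0.ne' hx.ne',
      Real.log_mul hC.ne' (by positivity), Real.log_div (by positivity) hx.ne',
      Real.log_mul (by positivity) hlog.ne', Real.log_mul hα.ne' hV.ne']
    norm_num
  have h2 : Real.log α ≤ -4 - (Real.log 4 + Real.log r + Real.log C) := by
    have h := Real.log_le_log hα hα'
    rwa [Real.log_div (Real.exp_pos _).ne' (by positivity), Real.log_exp,
      Real.log_mul (by positivity) hC.ne', Real.log_mul (by norm_num) hr0.ne'] at h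
  have h3 : Real.log (Real.log x) ≤ Real.log x / 4 + Real.log 4 := by
    have h := Real.log_le_sub_one_of_pos (by positivity : 0 < Real.log x / 4)
    rw [Real.log_div hlog.ne' (by norm_num)] at h
    linarith
  have h4 := Real.log_nonpos hV.le hV1
  have h5 := Real.log_nonneg hr
  rw [h1]
  linarith

/-- **Generalized KKL theorem** (Theorem 2.2 / Theorem 3.7 of the paper).
For all `b ≥ 1`, `ρ ∈ (0,1]`, `Δ ≥ 1`, `q ≥ 2` there is `α = α(b,ρ,Δ,q) > 0` such that for every
`n ≥ 1`, every alphabet of size `q`, every `ν` satisfying Assumption A, and every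
`f : Σ^n → {0,1}`, some coordinate `k` has `I_k(f) ≥ α · Var_ν(f) · log(n)/n`. -/
theorem generalized_KKL (b ρ : ℝ) (Δ q : ℕ) (hb : 1 ≤ b) (hρ0 : 0 < ρ) (hρ1 : ρ ≤ 1)
    (hΔ : 1 ≤ Δ) (hq : 2 ≤ q) :
    ∃ α : ℝ, 0 < α ∧
      ∀ (n : ℕ), 1 ≤ n →
        ∀ (σ : Type) [Fintype σ] [DecidableEq σ], Fintype.card σ = q →
          ∀ ν : Cfg σ n → ℝ, AssumptionA ν b ρ Δ →
            ∀ f : Cfg σ n → ℝ, (∀ x, f x = 0 ∨ f x = 1) →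
              ∃ k : Fin n,
                α * varnc ν f * Real.log n / n ≤ influence ν f k := by
  set r : ℕ := ⌈2 / ρ⌉₊ with hr
  have hrρ : 2 ≤ ρ * r := by
    have h := Nat.le_ceil (2 / ρ)
    rw [div_le_iff₀ hρ0] at h
    linarith
  have hr1 : (1 : ℝ) ≤ r := by
    have : 0 < r := Nat.ceil_pos.2 (by positivity)
    exact_mod_cast this
  set C : ℝ := Real.exp (2 * Δ * r) with hC
  have hC0 : 0 < C := Real.exp_pos _
  set H : ℝ := 2 * (1 + 4 * Δ * r) with hH
  have hH0 : 0 < H := by positivity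
  refine ⟨min (ρ / (8 * H)) (Real.exp (-4) / (4 * r * C)), by positivity, ?_⟩
  set α : ℝ := min (ρ / (8 * H)) (Real.exp (-4) / (4 * r * C)) with hα
  have hα0 : 0 < α := by positivity
  intro n hn σ _ _ _ ν hA f hf
  obtain ⟨hν, -, -, -, -, hL, G, hG, hdeg⟩ := hA
  by_contra! hcon
  set V := varnc ν f with hV
  set δ := α * V * Real.log n / n with hδ
  have hn0 : (0 : ℝ) < n := by positivity
  have hδ0 : 0 < δ := (influence_nonneg hν f ⟨0, hn⟩).trans_lt (hcon ⟨0, hn⟩)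
  have hV0 : 0 ≤ V := varnc_nonneg hν f
  have hlog0 : 0 ≤ Real.log n := Real.log_natCast_nonneg n
  have hVpos : 0 < V := hV0.lt_of_ne (by intro h; simp [hδ, ← h] at hδ0)
  have hlogpos : 0 < Real.log n := hlog0.lt_of_ne (by intro h; simp [hδ, ← h] at hδ0)
  have hnorm : ∀ i, normOne ν (lopLin ν i f) ≤ δ := fun i =>
    (normOne_lopLin_le_influence hν hf i).trans (hcon i).le
  have hdir : dirichlet ν f ≤ n * δ := by
    have h := Finset.sum_le_sum fun i (_ : i ∈ Finset.univ) =>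
      (ip_lopLin_le_normOne hν hf i).trans (hnorm i)
    simpa [dirichlet] using h
  have hfm : ∀ t < r * n, ∀ i, normOne ν (lopLin ν i ((stepLin ν ^ t) f)) ≤ C * δ := by
    intro t ht i
    refine (normOne_lopLin_stepLin_pow_le hν hn hG hdeg hδ0.le hnorm t i).trans ?_
    gcongr
    have ht' : (t : ℝ) ≤ r * n := by exact_mod_cast ht.le
    calc (1 + 2 * Δ / n : ℝ) ^ t ≤ Real.exp (2 * Δ / n) ^ t := by
          gcongr
          rw [add_comm]
          exact Real.add_one_le_exp _
      _ = Real.exp (t * (2 * Δ / n)) := (Real.exp_nat_mul _ _).symm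
      _ ≤ C := by
          rw [hC, Real.exp_le_exp, mul_div_assoc', div_le_iff₀ hn0]
          have : t * (2 * Δ : ℝ) ≤ r * n * (2 * Δ) := by gcongr
          linarith
  have hmain := sum_dirichlet_mul_log_le hν hρ0 hn hL hG hdeg (mul_pos hC0 hδ0)
    (by positivity : 0 < V / (r * n)) hfm
  have hgain : Real.log n / 2 + 8 ≤ Real.log (V / (r * n) / (C * δ) ^ 2) :=
    half_log_add_le_log hα0 hVpos (varnc_le_one hν hf) hC0 hr1 hn0 hlogpos (min_le_right _ _)
  have hdecay : varnc ν ((stepLin ν ^ (r * n)) f) ≤ V / 2 := by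
    refine (varnc_stepLin_pow_le hν hρ0 hρ1 hn hL f (r * n)).trans ?_
    have hn1 : (1 : ℝ) ≤ n := by exact_mod_cast hn
    have h1 : (1 - ρ / (2 * n)) ^ (r * n) ≤ Real.exp (-1) := by
      calc (1 - ρ / (2 * n)) ^ (r * n) ≤ Real.exp (-(ρ / (2 * n))) ^ (r * n) := by
            refine pow_le_pow_left₀ ?_ (Real.one_sub_le_exp_neg _) _
            rw [sub_nonneg, div_le_one (by positivity)]
            linarith
        _ = Real.exp ((r * n : ℕ) * -(ρ / (2 * n))) := (Real.exp_nat_mul _ _).symm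
        _ ≤ Real.exp (-1) := by
            rw [Real.exp_le_exp]
            have : ((r * n : ℕ) : ℝ) * -(ρ / (2 * n)) = -(ρ * r / 2) := by
              push_cast
              field_simp
            rw [this]
            linarith
    have h2 : Real.exp (-1) ≤ 1 / 2 := by
      rw [Real.exp_neg, inv_eq_one_div]
      have := Real.add_one_le_exp (1 : ℝ)
      exact one_div_le_one_div_of_le (by norm_num) (by linarith)
    calc _ ≤ 1 / 2 * V := mul_le_mul_of_nonneg_right (h1.trans h2) hV0
      _ = V / 2 := by ring
  have hS : n * V / 4 ≤ ∑ t ∈ Finset.range (r * n), dirichlet ν ((stepLin ν ^ t) f) := by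
    refine le_trans ?_ (le_sum_dirichlet hν hn f (r * n))
    have : n / 2 * (V / 2) ≤ n / 2 * (V - varnc ν ((stepLin ν ^ (r * n)) f)) := by
      gcongr
      linarith
    linarith
  have hSlog : n * V / 4 * (Real.log n / 2 + 8) ≤
      (∑ t ∈ Finset.range (r * n), dirichlet ν ((stepLin ν ^ t) f))
        * Real.log (V / (r * n) / (C * δ) ^ 2) := by
    gcongr
    exact le_trans (by positivity) hS
  have hθ : ((r * n : ℕ) : ℝ) * n * (V / (r * n)) = n * V := by
    push_cast
    field_simp
  rw [hθ] at hmain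
  have hupper : 2 * ((n + 4 * Δ * ((r * n : ℕ) : ℝ)) * dirichlet ν f) ≤
      ρ * (n * V * (Real.log n / 8)) := by
    calc 2 * ((n + 4 * Δ * ((r * n : ℕ) : ℝ)) * dirichlet ν f)
        ≤ 2 * ((n + 4 * Δ * ((r * n : ℕ) : ℝ)) * (n * δ)) := by gcongr
      _ = α * (H * (n * V * Real.log n)) := by
          rw [hδ, hH]
          push_cast
          field_simp
      _ ≤ ρ / (8 * H) * (H * (n * V * Real.log n)) := by
          gcongr
          exact min_le_left _ _
      _ = ρ * (n * V * (Real.log n / 8)) := by field_simp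
  have hlower : ρ * (n * V * (Real.log n / 8 + 1)) ≤
      ρ * ((∑ t ∈ Finset.range (r * n), dirichlet ν ((stepLin ν ^ t) f))
        * Real.log (V / (r * n) / (C * δ) ^ 2) - n * V) := by
    gcongr
    linarith
  have hpos : 0 < ρ * (n * V) := by positivity
  linarith
end
end

section
/- Let G be a graph on vertex set [n] of maximum degree Δ. Then for every i ∈ [n] and every k ≥ 1, the set S_{k,i} has cardinality at most (Δ + 1)^k · k^k. -/
open scoped Classical BigOperators

noncomputable section

/-- The index sets `S_{k,i}`: tuples `(j_1,…,j_k)` with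
`j_ℓ ∈ N⁺({i, j_1, …, j_{ℓ-1}})` for all `ℓ`, where `N⁺(U)` is `U` together with all
neighbors of `U` in `G`. -/
def Sset {m : ℕ} (G : SimpleGraph (Fin m)) (k : ℕ) (i : Fin m) : Finset (Fin k → Fin m) :=
  Finset.univ.filter fun jj => ∀ ℓ : Fin k,
    jj ℓ = i ∨ G.Adj i (jj ℓ) ∨ ∃ m' : Fin k, m' < ℓ ∧ (jj ℓ = jj m' ∨ G.Adj (jj m') (jj ℓ))

/-- In a graph of maximum degree at most `Δ`, closed neighborhoods have at most `Δ + 1` elements. -/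
theorem card_closedNeighborhood_le {n : ℕ} {G : SimpleGraph (Fin n)} {Δ : ℕ} (hG : MaxDegLE G Δ)
    (v : Fin n) : (insert v (Finset.univ.filter fun j => G.Adj v j)).card ≤ Δ + 1 :=
  (Finset.card_insert_le _ _).trans (Nat.add_le_add_right (hG v) 1)

theorem init_mem_Sset {n k : ℕ} {G : SimpleGraph (Fin n)} {i : Fin n} {jj : Fin (k + 1) → Fin n}
    (hjj : jj ∈ Sset G (k + 1) i) : (Fin.init jj : Fin k → Fin n) ∈ Sset G k i := by
  simp only [Sset, Finset.mem_filter, Finset.mem_univ, true_and] at hjj ⊢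
  intro ℓ
  rcases hjj ℓ.castSucc with h | h | ⟨m, hm, h⟩
  · exact Or.inl h
  · exact Or.inr (Or.inl h)
  · exact Or.inr (Or.inr ⟨⟨m, lt_trans hm ℓ.2⟩, hm, h⟩)

/-- The last entry of a tuple in `Sset` lies in the closed neighborhood of `i` or of an
earlier entry. -/
theorem last_mem_biUnion_of_mem_Sset {n k : ℕ} {G : SimpleGraph (Fin n)} {i : Fin n}
    {jj : Fin (k + 1) → Fin n} (hjj : jj ∈ Sset G (k + 1) i) :
    jj (Fin.last k) ∈ (Finset.univ : Finset (Fin (k + 1))).biUnion fun a =>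
      insert (Fin.cons (α := fun _ => Fin n) i (Fin.init jj) a)
        (Finset.univ.filter fun j =>
          G.Adj (Fin.cons (α := fun _ => Fin n) i (Fin.init jj) a) j) := by
  simp only [Sset, Finset.mem_filter, Finset.mem_univ, true_and] at hjj
  simp only [Finset.mem_biUnion, Finset.mem_insert, Finset.mem_filter, Finset.mem_univ, true_and]
  rcases hjj (Fin.last k) with h | h | ⟨m, hm, h⟩
  · exact ⟨0, Or.inl h⟩
  · exact ⟨0, Or.inr h⟩
  · exact ⟨Fin.succ ⟨m, hm⟩, h⟩

theorem card_Sset_succ_le {n : ℕ} {G : SimpleGraph (Fin n)} {Δ : ℕ} (hG : MaxDegLE G Δ)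
    (i : Fin n) (k : ℕ) :
    (Sset G (k + 1) i).card ≤ (k + 1) * (Δ + 1) * (Sset G k i).card := by
  refine Finset.card_le_mul_card_image_of_maps_to
    (f := fun jj : Fin (k + 1) → Fin n => (Fin.init jj : Fin k → Fin n))
    (fun _ => init_mem_Sset) _ fun b _ => ?_
  calc
    _ ≤ ((Finset.univ : Finset (Fin (k + 1))).biUnion fun a =>
          insert (Fin.cons (α := fun _ => Fin n) i b a) (Finset.univ.filter fun j =>
            G.Adj (Fin.cons (α := fun _ => Fin n) i b a) j)).card := by
      refine Finset.card_le_card_of_injOn (fun jj => jj (Fin.last k)) ?_ ?_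
      · intro jj hjj
        obtain ⟨hmem, rfl⟩ := Finset.mem_filter.1 hjj
        exact last_mem_biUnion_of_mem_Sset hmem
      · intro x hx y hy hxy
        have hx' := (Finset.mem_filter.1 hx).2
        have hy' := (Finset.mem_filter.1 hy).2
        dsimp only at hx' hy' hxy
        rw [← Fin.snoc_init_self x, ← Fin.snoc_init_self y, hx', hy', hxy]
    _ ≤ (Finset.univ : Finset (Fin (k + 1))).card * (Δ + 1) :=
      Finset.card_biUnion_le_card_mul _ _ _ fun _ _ => card_closedNeighborhood_le hG _
    _ = (k + 1) * (Δ + 1) := by rw [Finset.card_univ, Fintype.card_fin]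

theorem card_Sset_le_factorial {n : ℕ} {G : SimpleGraph (Fin n)} {Δ : ℕ} (hG : MaxDegLE G Δ)
    (i : Fin n) (k : ℕ) : (Sset G k i).card ≤ (Δ + 1) ^ k * k.factorial := by
  induction k with
  | zero => simpa using Finset.card_le_univ (Sset G 0 i)
  | succ k ih =>
    calc
      _ ≤ (k + 1) * (Δ + 1) * (Sset G k i).card := card_Sset_succ_le hG i k
      _ ≤ (k + 1) * (Δ + 1) * ((Δ + 1) ^ k * k.factorial) := Nat.mul_le_mul_left _ ih
      _ = (Δ + 1) ^ (k + 1) * (k + 1).factorial := by rw [Nat.factorial_succ]; ring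

/-- **Size of `S_{k,i}`** (Lemma 3.3 of the paper): if `G` has maximum degree `Δ` then
`|S_{k,i}| ≤ (Δ+1)^k k^k` for every `i` and `k ≥ 1`. -/
theorem card_Sset_le {n : ℕ} (G : SimpleGraph (Fin n)) (Δ : ℕ) (hG : MaxDegLE G Δ)
    (i : Fin n) (k : ℕ) (hk : 1 ≤ k) :
    (Sset G k i).card ≤ (Δ + 1) ^ k * k ^ k :=
  (card_Sset_le_factorial hG i k).trans (Nat.mul_le_mul_left _ k.factorial_le_pow)
end
end

section
/- Let ν be a fully supported, b-marginally bounded probability measure on Σ^n with q = |Σ|. Then for every f : Σ^n → {0,1}, every i ∈ [n], and every p ≥ 1: I_i(f) ≥ E_ν[|L_i f|^p] ≥ I_i(f)/(qb)^p. -/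
open scoped Classical BigOperators

noncomputable section

variable {σ : Type} [Fintype σ] [DecidableEq σ] {n : ℕ}

/-- The configurations agreeing with `x` outside coordinate `i`. -/
def fiber (i : Fin n) (x : Cfg σ n) : Finset (Cfg σ n) :=
  Finset.univ.filter (fun y : Cfg σ n => ∀ j, j ≠ i → y j = x j)

lemma mem_fiber {i : Fin n} {x y : Cfg σ n} :
    y ∈ fiber i x ↔ ∀ j, j ≠ i → y j = x j := by
  simp [fiber]

lemma update_mem_fiber (i : Fin n) (x : Cfg σ n) (a : σ) :
    Function.update x i a ∈ fiber i x :=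
  mem_fiber.2 fun _ hj => Function.update_of_ne hj _ _

lemma eq_update_of_mem_fiber {i : Fin n} {x y : Cfg σ n} (hy : y ∈ fiber i x) :
    Function.update x i (y i) = y := by
  ext j
  by_cases hj : j = i
  · subst hj; simp
  · rw [Function.update_of_ne hj, mem_fiber.1 hy j hj]

lemma card_fiber_le (i : Fin n) (x : Cfg σ n) : (fiber i x).card ≤ Fintype.card σ := by
  rw [← Finset.card_univ]
  refine Finset.card_le_card_of_injOn (fun y => y i) (fun _ _ => by simp) ?_
  intro y hy z hz h
  rw [← eq_update_of_mem_fiber hy, ← eq_update_of_mem_fiber hz]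
  exact congrArg _ h

lemma sum_fiber_pos {ν : Cfg σ n → ℝ} (hν : ∀ x, 0 < ν x) (i : Fin n) (x : Cfg σ n) :
    0 < ∑ y ∈ fiber i x, ν y :=
  Finset.sum_pos (fun y _ => hν y) ⟨x, mem_fiber.2 fun _ _ => rfl⟩

lemma MargBounded.le_mul_of_mem_fiber {ν : Cfg σ n → ℝ} {b : ℝ} (hmb : MargBounded ν b)
    (hν : ∀ x, 0 < ν x) (hb : 1 ≤ b) {i : Fin n} {x y z : Cfg σ n}
    (hy : y ∈ fiber i x) (hz : z ∈ fiber i x) : ν z ≤ b * ν y := by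
  by_cases hzy : z = y
  · subst hzy
    nlinarith [hν z]
  · have hd : hammingDist z y = 1 := by
      refine le_antisymm ?_ (Nat.one_le_iff_ne_zero.2 (hammingDist_ne_zero.2 hzy))
      rw [← Finset.card_singleton i]
      refine Finset.card_le_card fun j hj => ?_
      by_contra hji
      rw [Finset.mem_singleton] at hji
      refine (Finset.mem_filter.1 hj).2 ?_
      rw [mem_fiber.1 hy j hji, mem_fiber.1 hz j hji]
    exact (div_le_iff₀ (hν y)).1 (hmb z y hd).2

lemma abs_Lop_eq {ν : Cfg σ n → ℝ} (hν : ∀ x, 0 < ν x) {f : Cfg σ n → ℝ}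
    (hf : ∀ x, f x = 0 ∨ f x = 1) (i : Fin n) (x : Cfg σ n) :
    |Lop ν i f x| = (∑ y ∈ fiber i x, ν y * |f y - f x|) / ∑ y ∈ fiber i x, ν y := by
  have hS := sum_fiber_pos hν i x
  have hL : Lop ν i f x =
      (∑ y ∈ fiber i x, ν y * (f y - f x)) / ∑ y ∈ fiber i x, ν y := by
    simp only [mul_sub, Finset.sum_sub_distrib, ← Finset.sum_mul]
    rw [sub_div, mul_div_cancel_left₀ _ hS.ne']
    rfl
  rw [hL, abs_div, abs_of_pos hS]
  congr 1
  rcases hf x with hx | hx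
  · have h : ∀ y, |f y - f x| = f y - f x := fun y =>
      abs_of_nonneg (by rcases hf y with h | h <;> norm_num [h, hx])
    simp only [h]
    refine abs_of_nonneg (Finset.sum_nonneg fun y _ => ?_)
    rw [← h y]
    exact mul_nonneg (hν y).le (abs_nonneg _)
  · have h : ∀ y, |f y - f x| = -(f y - f x) := fun y =>
      abs_of_nonpos (by rcases hf y with h | h <;> norm_num [h, hx])
    simp only [h, mul_neg, Finset.sum_neg_distrib]
    refine abs_of_nonpos (Finset.sum_nonpos fun y _ => ?_)
    have := mul_nonneg (hν y).le (abs_nonneg (f y - f x))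
    rw [h y] at this
    linarith

lemma abs_Lop_le_one {ν : Cfg σ n → ℝ} (hν : ∀ x, 0 < ν x) {f : Cfg σ n → ℝ}
    (hf : ∀ x, f x = 0 ∨ f x = 1) (i : Fin n) (x : Cfg σ n) : |Lop ν i f x| ≤ 1 := by
  rw [abs_Lop_eq hν hf]
  refine div_le_one_of_le₀ (Finset.sum_le_sum fun y _ => ?_) (sum_fiber_pos hν i x).le
  refine mul_le_of_le_one_right (hν y).le ?_
  rcases hf x with hx | hx <;> rcases hf y with hy | hy <;> norm_num [hx, hy]

lemma Lop_eq_zero {ν : Cfg σ n → ℝ} (hν : ∀ x, 0 < ν x) {f : Cfg σ n → ℝ}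
    (hf : ∀ x, f x = 0 ∨ f x = 1) {i : Fin n} {x : Cfg σ n}
    (hx : ∀ a, f (Function.update x i a) = f x) : Lop ν i f x = 0 := by
  rw [← abs_eq_zero, abs_Lop_eq hν hf, Finset.sum_eq_zero, zero_div]
  intro y hy
  rw [← eq_update_of_mem_fiber hy, hx]
  simp

lemma inv_le_abs_Lop {ν : Cfg σ n → ℝ} (hν : ∀ x, 0 < ν x) {b : ℝ} (hb : 1 ≤ b)
    (hmb : MargBounded ν b) {f : Cfg σ n → ℝ} (hf : ∀ x, f x = 0 ∨ f x = 1)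
    {i : Fin n} {x : Cfg σ n} {a : σ} (ha : f (Function.update x i a) ≠ f x) :
    ((Fintype.card σ : ℝ) * b)⁻¹ ≤ |Lop ν i f x| := by
  set y := Function.update x i a
  have hy : y ∈ fiber i x := update_mem_fiber i x a
  have hq : (0 : ℝ) < Fintype.card σ := by
    exact_mod_cast Fintype.card_pos_iff.2 ⟨a⟩
  have hqb : 0 < (Fintype.card σ : ℝ) * b := mul_pos hq (by linarith)
  have hsum : ∑ z ∈ fiber i x, ν z ≤ (Fintype.card σ : ℝ) * b * ν y := by
    calc ∑ z ∈ fiber i x, ν z ≤ (fiber i x).card • (b * ν y) :=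
          Finset.sum_le_card_nsmul _ _ _ fun z hz => hmb.le_mul_of_mem_fiber hν hb hy hz
      _ ≤ (Fintype.card σ : ℝ) * (b * ν y) := by
          rw [nsmul_eq_mul]
          refine mul_le_mul_of_nonneg_right ?_ (mul_nonneg (by linarith) (hν y).le)
          exact_mod_cast card_fiber_le i x
      _ = _ := by ring
  have hterm : ν y ≤ ∑ z ∈ fiber i x, ν z * |f z - f x| := by
    have h1 : |f y - f x| = 1 := by
      rcases hf x with h | h <;> rcases hf y with h' | h' <;> simp_all
    calc ν y = ν y * |f y - f x| := by rw [h1, mul_one]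
      _ ≤ _ := Finset.single_le_sum (f := fun z => ν z * |f z - f x|)
          (fun z _ => mul_nonneg (hν z).le (abs_nonneg _)) hy
  rw [abs_Lop_eq hν hf, le_div_iff₀ (sum_fiber_pos hν i x), inv_mul_le_iff₀ hqb]
  exact hsum.trans (mul_le_mul_of_nonneg_left hterm hqb.le)

/-- **Influences and derivatives** (Lemma 3.8 of the paper).
If `ν` is a fully supported `b`-marginally bounded probability measure on `Σ^n` (`q = |Σ|`),
then for every `f : Σ^n → {0,1}`, every `i`, and every `p ≥ 1`,
`I_i(f) ≥ E_ν|L_i f|^p ≥ I_i(f)/(qb)^p`. -/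
theorem influence_vs_derivative {σ : Type} [Fintype σ] [DecidableEq σ] {n : ℕ}
    (ν : Cfg σ n → ℝ) (hν : IsProb ν) (b : ℝ) (hb : 1 ≤ b) (hmb : MargBounded ν b)
    (f : Cfg σ n → ℝ) (hf : ∀ x, f x = 0 ∨ f x = 1) (i : Fin n) (p : ℝ) (hp : 1 ≤ p) :
    expct ν (fun x => |Lop ν i f x| ^ p) ≤ influence ν f i ∧
      influence ν f i / ((Fintype.card σ : ℝ) * b) ^ p ≤
        expct ν (fun x => |Lop ν i f x| ^ p) := by
  have hp0 : 0 < p := by linarith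
  obtain ⟨hpos, -⟩ := hν
  unfold expct influence
  rw [Finset.sum_filter]
  refine ⟨Finset.sum_le_sum fun x _ => ?_, ?_⟩
  · split_ifs with hx
    · exact mul_le_of_le_one_right (hpos x).le
        (Real.rpow_le_one (abs_nonneg _) (abs_Lop_le_one hpos hf i x) hp0.le)
    · push Not at hx
      simp [Lop_eq_zero hpos hf hx, Real.zero_rpow hp0.ne']
  · rw [Finset.sum_div]
    refine Finset.sum_le_sum fun x _ => ?_
    have hqb : 0 ≤ (Fintype.card σ : ℝ) * b := mul_nonneg (Nat.cast_nonneg _) (by linarith)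
    split_ifs with hx
    · obtain ⟨a, ha⟩ := hx
      rw [div_eq_mul_inv, ← Real.inv_rpow hqb]
      exact mul_le_mul_of_nonneg_left (Real.rpow_le_rpow (inv_nonneg.2 hqb)
        (inv_le_abs_Lop hpos hb hmb hf ha) hp0.le) (hpos x).le
    · rw [zero_div]
      exact mul_nonneg (hpos x).le (Real.rpow_nonneg (abs_nonneg _) _)
end
end
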